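/- Let q ∈ (-1,0). For every integer k ≥ 0 one has (q²;q²)_∞ · ∑_{n=0}^∞ (q^{2n} / (q²;q²)_n) · (q^{2n}/(1-q))^k = (-q;q)_k · [k]_q!. (Equivalently: the nonnegative discrete measure ρ_{ν_{q,q}} = (q²;q²)_∞ ∑_{n=0}^∞ (q^{2n}/(q²;q²)_n) δ_{(1-q)^{-1/2} (-q)^n}, which is the radial q²-Gaussian Bargmann measure dilated by (1+q)^{1/2}, has (2k)-th moment (-q;q)_k [k]_q! = (1+q)^k [k]_{q²}!.) -/

import Mathlib

/-- The q-Pochhammer symbol `(a;q)_k = ∏_{i=0}^{k-1} (1 - a q^i)`. -/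
noncomputable def qPoch (a q : ℝ) (k : ℕ) : ℝ :=
  ∏ i ∈ Finset.range k, (1 - a * q ^ i)

/-- The infinite q-Pochhammer symbol `(a;q)_∞ = ∏_{i=0}^{∞} (1 - a q^i)`. -/
noncomputable def qPochInf (a q : ℝ) : ℝ :=
  ∏' i : ℕ, (1 - a * q ^ i)

/-- The q-factorial `[k]_q! = ∏_{ℓ=1}^k (1 + q + ⋯ + q^{ℓ-1})`. -/
noncomputable def qFact (q : ℝ) (k : ℕ) : ℝ :=
  ∏ l ∈ Finset.range k, (∑ i ∈ Finset.range (l + 1), q ^ i)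

theorem qPoch_zero (a q : ℝ) : qPoch a q 0 = 1 := by
  simp [qPoch]

theorem qPoch_succ (a q : ℝ) (k : ℕ) :
    qPoch a q (k + 1) = qPoch a q k * (1 - a * q ^ k) :=
  Finset.prod_range_succ _ _

theorem one_sub_mul_pow_pos {p : ℝ} (hp₀ : 0 ≤ p) (hp₁ : p < 1) (i : ℕ) :
    0 < 1 - p * p ^ i := by
  rw [← pow_succ']
  exact sub_pos.2 (pow_lt_one₀ hp₀ hp₁ i.succ_ne_zero)

theorem qPoch_self_pos {p : ℝ} (hp₀ : 0 ≤ p) (hp₁ : p < 1) (n : ℕ) : 0 < qPoch p p n :=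
  Finset.prod_pos fun i _ => one_sub_mul_pow_pos hp₀ hp₁ i

theorem summable_norm_neg_mul_pow {p : ℝ} (a : ℝ) (hp₀ : 0 ≤ p) (hp₁ : p < 1) :
    Summable fun i : ℕ => ‖-(a * p ^ i)‖ :=
  ((summable_geometric_of_lt_one hp₀ hp₁).mul_left a).neg.norm

theorem tendsto_qPoch {p : ℝ} (a : ℝ) (hp₀ : 0 ≤ p) (hp₁ : p < 1) :
    Filter.Tendsto (qPoch a p) Filter.atTop (nhds (qPochInf a p)) := by
  have h := multipliable_one_add_of_summable (summable_norm_neg_mul_pow a hp₀ hp₁)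
  simp only [← sub_eq_add_neg] at h
  exact h.hasProd.tendsto_prod_nat

theorem qPochInf_self_ne_zero {p : ℝ} (hp₀ : 0 ≤ p) (hp₁ : p < 1) : qPochInf p p ≠ 0 := by
  have h := tprod_one_add_ne_zero_of_summable (f := fun i : ℕ => -(p * p ^ i))
    (fun i => by
      rw [← sub_eq_add_neg]
      exact (one_sub_mul_pow_pos hp₀ hp₁ i).ne')
    (summable_norm_neg_mul_pow p hp₀ hp₁)
  simpa only [← sub_eq_add_neg, qPochInf] using h

theorem sum_range_pow_div_qPoch {p : ℝ} (hp₀ : 0 ≤ p) (hp₁ : p < 1) (N : ℕ) :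
    ∑ n ∈ Finset.range (N + 1), p ^ n / qPoch p p n = (qPoch p p N)⁻¹ := by
  induction N with
  | zero => simp [qPoch_zero]
  | succ N ih =>
    have h₁ := (qPoch_self_pos hp₀ hp₁ N).ne'
    have h₂ := (one_sub_mul_pow_pos hp₀ hp₁ N).ne'
    rw [Finset.sum_range_succ, ih, qPoch_succ]
    field_simp
    ring

/-- Euler's identity `∑ xⁿ / (p;p)_n = 1 / (x;p)_∞` at the points `x = p ^ (k + 1)`. -/
theorem hasSum_pow_mul_pow_div_qPoch {p : ℝ} (hp₀ : 0 ≤ p) (hp₁ : p < 1) (k : ℕ) :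
    HasSum (fun n : ℕ => p ^ n / qPoch p p n * (p ^ n) ^ k) (qPoch p p k / qPochInf p p) := by
  induction k with
  | zero =>
    simp only [pow_zero, mul_one, qPoch_zero, one_div]
    rw [hasSum_iff_tendsto_nat_of_nonneg
      fun n => div_nonneg (pow_nonneg hp₀ n) (qPoch_self_pos hp₀ hp₁ n).le]
    rw [← Filter.tendsto_add_atTop_iff_nat 1]
    simp only [sum_range_pow_div_qPoch hp₀ hp₁]
    exact (tendsto_qPoch p hp₀ hp₁).inv₀ (qPochInf_self_ne_zero hp₀ hp₁)
  | succ k ih =>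
    have hdiff : HasSum (fun n : ℕ => p ^ n / qPoch p p n * (p ^ n) ^ k * (1 - p ^ n))
        (p * p ^ k * (qPoch p p k / qPochInf p p)) := by
      rw [← hasSum_nat_add_iff' 1]
      simp only [Finset.sum_range_one, pow_zero, sub_self, mul_zero, sub_zero]
      refine (ih.mul_left (p * p ^ k)).congr_fun fun n => ?_
      have h₁ := (qPoch_self_pos hp₀ hp₁ n).ne'
      have h₂ := (one_sub_mul_pow_pos hp₀ hp₁ n).ne'
      rw [qPoch_succ, pow_succ' p n, mul_pow]
      field_simp
    have hval : qPoch p p (k + 1) / qPochInf p p =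
        qPoch p p k / qPochInf p p - p * p ^ k * (qPoch p p k / qPochInf p p) := by
      rw [qPoch_succ]
      ring
    rw [hval]
    exact (ih.sub hdiff).congr_fun fun n => by ring

theorem qPoch_sq_eq (q : ℝ) (k : ℕ) :
    qPoch (q ^ 2) (q ^ 2) k = qPoch (-q) q k * qFact q k * (1 - q) ^ k := by
  induction k with
  | zero => simp [qPoch, qFact]
  | succ k ih =>
    have hF : qFact q (k + 1) = qFact q k * ∑ i ∈ Finset.range (k + 1), q ^ i :=
      Finset.prod_range_succ _ _
    have hg := mul_neg_geom_sum q (k + 1)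
    rw [qPoch_succ, qPoch_succ, hF, ih]
    linear_combination
      -(qPoch (-q) q k * qFact q k * (1 - q) ^ k * (1 + q * q ^ k)) * hg

/-- For `q ∈ (-1,0)`, the (2k)-th moment of the nonnegative discrete measure
`ρ_{ν_{q,q}} = (q²;q²)_∞ ∑_n (q^{2n}/(q²;q²)_n) δ_{(1-q)^{-1/2} (-q)^n}`
equals `(-q;q)_k [k]_q!`. -/
theorem moments_of_rho_nu_q_q (q : ℝ) (hq : q ∈ Set.Ioo (-1 : ℝ) 0) (k : ℕ) :
    qPochInf (q ^ 2) (q ^ 2) *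
      ∑' n : ℕ, q ^ (2 * n) / qPoch (q ^ 2) (q ^ 2) n * (q ^ (2 * n) / (1 - q)) ^ k
      = qPoch (-q) q k * qFact q k := by
  obtain ⟨h₁, h₂⟩ := hq
  have hp₀ : 0 ≤ q ^ 2 := sq_nonneg q
  have hp₁ : q ^ 2 < 1 := by nlinarith
  have hq₁ : 1 - q ≠ 0 := by linarith
  have hsum := (hasSum_pow_mul_pow_div_qPoch hp₀ hp₁ k).div_const ((1 - q) ^ k)
  simp only [← pow_mul q 2, mul_div_assoc, ← div_pow] at hsum
  have hne := qPochInf_self_ne_zero hp₀ hp₁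
  rw [hsum.tsum_eq, qPoch_sq_eq]
  field_simp
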